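/- arXiv:1310.7863 — 5 statements merged into one kernel-verified Lean document; each statement's English description precedes it below -/
import Mathlib

section
/- Let X be a set that is the union of an increasing sequence X₁ ⊆ X₂ ⊆ ⋯ of subsets, where each Xₙ carries a topology such that every inclusion Xₙ → Xₙ₊₁ is continuous, and equip X with the DL-topology. If Oₙ ⊆ Xₙ is open in Xₙ for each n and O₁ ⊆ O₂ ⊆ ⋯, then O = ⋃ₙ Oₙ is open in X, and moreover the DL-topology on O determined by the sequence (Oₙ) (each Oₙ with its subspace topology from Xₙ) coincides with the subspace topology that O inherits from X. -/
theorem dl_incl_cont {X : Type*} (A : ℕ → Set X) (hmonoA : Monotone A)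
    (T : ∀ n, TopologicalSpace (A n))
    (hcont : ∀ n, @Continuous _ _ (T n) (T (n + 1))
      (Set.inclusion (hmonoA (Nat.le_succ n)))) (m n : ℕ) (h : m ≤ n) :
    @Continuous _ _ (T m) (T n) (Set.inclusion (hmonoA h)) := by
  induction n, h using Nat.le_induction with
  | base => exact @continuous_id _ (T m)
  | succ n h ih => exact @Continuous.comp _ _ _ (T m) (T n) (T (n + 1)) _ _ (hcont n) ih

theorem dl_open {X : Type*} (A : ℕ → Set X) (hmonoA : Monotone A)
    (T : ∀ n, TopologicalSpace (A n))
    (hcont : ∀ n, @Continuous _ _ (T n) (T (n + 1))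
      (Set.inclusion (hmonoA (Nat.le_succ n))))
    (O : ℕ → Set X) (hmonoO : Monotone O) (S : Set X) (hS : S ⊆ ⋃ n, O n)
    (hopen : ∀ n, @IsOpen (A n) (T n) (((↑) : A n → X) ⁻¹' (S ∩ O n))) :
    @IsOpen X (⨆ n, (T n).coinduced ((↑) : A n → X)) S := by
  rw [isOpen_iSup_iff]
  intro m
  rw [isOpen_coinduced]
  have : (((↑) : A m → X) ⁻¹' S) = ⋃ n, ⋃ h : m ≤ n,
      (Set.inclusion (hmonoA h)) ⁻¹' (((↑) : A n → X) ⁻¹' (S ∩ O n)) := by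
    ext x
    simp only [Set.mem_preimage, Set.mem_iUnion, Set.coe_inclusion, Set.mem_inter_iff]
    constructor
    · intro hx
      obtain ⟨k, hk⟩ := Set.mem_iUnion.1 (hS hx)
      exact ⟨max m k, le_max_left _ _, hx, hmonoO (le_max_right _ _) hk⟩
    · rintro ⟨_, _, hx, _⟩
      exact hx
  rw [this]
  letI := T m
  refine isOpen_iUnion fun n => isOpen_iUnion fun h => ?_
  exact @IsOpen.preimage _ _ (T m) (T n) _ (dl_incl_cont A hmonoA T hcont m n h) _ (hopen n)

/-- If `X = ⋃ n, A n` carries the DL-topology of an increasing sequence of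
topological spaces `(A n, T n)` (inclusions continuous), and `O n ⊆ A n` is an increasing
sequence of sets, each `O n` open in `A n`, then `⋃ n, O n` is open in `X` and the
DL-topology on `⋃ n, O n` induced by the sequence `(O n)` (each with the subspace topology
from `A n`) coincides with the subspace topology inherited from `X`. -/
theorem stmt1 {X : Type*} (A : ℕ → Set X) (hmonoA : Monotone A)
    (hunion : ⋃ n, A n = Set.univ)
    (T : ∀ n, TopologicalSpace (A n))
    (hcont : ∀ n, @Continuous _ _ (T n) (T (n + 1))
      (Set.inclusion (hmonoA (Nat.le_succ n))))
    (O : ℕ → Set X) (hOA : ∀ n, O n ⊆ A n) (hmonoO : Monotone O)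
    (hopen : ∀ n, @IsOpen (A n) (T n) (((↑) : A n → X) ⁻¹' O n)) :
    @IsOpen X (⨆ n, (T n).coinduced ((↑) : A n → X)) (⋃ n, O n) ∧
    (⨆ n, TopologicalSpace.coinduced
        (fun x : ((((↑) : A n → X) ⁻¹' O n : Set (A n))) =>
          (⟨(x.1 : X), Set.mem_iUnion.2 ⟨n, x.2⟩⟩ : (⋃ n, O n : Set X)))
        (TopologicalSpace.induced Subtype.val (T n))) =
      TopologicalSpace.induced ((↑) : (⋃ n, O n : Set X) → X)
        (⨆ n, (T n).coinduced ((↑) : A n → X)) := by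
  constructor
  · refine dl_open A hmonoA T hcont O hmonoO _ subset_rfl fun n => ?_
    rw [Set.inter_eq_right.2 (Set.subset_iUnion O n)]
    exact hopen n
  · apply le_antisymm
    · refine iSup_le fun n => ?_
      rw [← continuous_iff_coinduced_le, continuous_induced_rng]
      refine continuous_iSup_rng (i := n) ?_
      exact @Continuous.comp _ _ _ (_) (T n) (_)
        (Subtype.val : ((((↑) : A n → X) ⁻¹' O n : Set (A n))) → A n) (Subtype.val : A n → X)
        continuous_coinduced_rng continuous_induced_dom
    · intro U hU
      refine (@isOpen_induced_iff _ _ (_) _ _).2 ⟨Subtype.val '' U, ?_,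
        Set.preimage_image_eq _ Subtype.val_injective⟩
      refine dl_open A hmonoA T hcont O hmonoO _ (by rintro _ ⟨x, _, rfl⟩; exact x.2) fun n => ?_
      have h := isOpen_coinduced.1 (isOpen_iSup_iff.1 hU n)
      obtain ⟨W, hW, hWU⟩ := isOpen_induced_iff.1 h
      have : (((↑) : A n → X) ⁻¹' (Subtype.val '' U ∩ O n)) = W ∩ (((↑) : A n → X) ⁻¹' O n) := by
        ext x
        simp only [Set.mem_preimage, Set.mem_inter_iff]
        refine and_congr_left fun hx => ?_
        have h1 := Set.ext_iff.1 hWU ⟨x, hx⟩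
        simp only [Set.mem_preimage] at h1
        rw [h1]
        constructor
        · rintro ⟨y, hy, hyx⟩
          have : y = ⟨(x : X), Set.mem_iUnion.2 ⟨n, hx⟩⟩ := Subtype.ext hyx
          exact this ▸ hy
        · intro hy
          exact ⟨_, hy, rfl⟩
      rw [this]
      exact @IsOpen.inter _ (T n) _ _ hW (hopen n)
end

section
/- Let X be a set that is the union of an increasing sequence X₁ ⊆ X₂ ⊆ ⋯ of subsets, where each Xₙ carries a topology such that every inclusion Xₙ → Xₙ₊₁ is continuous, and equip X with the DL-topology. If each Xₙ is a locally compact Hausdorff space, then X is Hausdorff. -/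
lemma step_aux {Y Z : Type*} [TopologicalSpace Y] [TopologicalSpace Z] [T2Space Z]
    [LocallyCompactSpace Z] (f : Y → Z) (hf : Continuous f) (hi : Function.Injective f)
    (K L : Set Y) (hK : IsCompact K) (hL : IsCompact L) (hd : Disjoint K L) :
    ∃ p : Set Z × Set Z, (IsCompact p.1 ∧ IsCompact p.2 ∧ Disjoint p.1 p.2) ∧
      f '' K ⊆ interior p.1 ∧ f '' L ⊆ interior p.2 := by
  obtain ⟨U, V, hU, hV, hKU, hLV, hUV⟩ :=
    SeparatedNhds.of_isCompact_isCompact (hK.image hf) (hL.image hf)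
      ((Set.disjoint_image_iff hi).2 hd)
  obtain ⟨K', hK', h1, h2⟩ := exists_compact_between (hK.image hf) hU hKU
  obtain ⟨L', hL', h3, h4⟩ := exists_compact_between (hL.image hf) hV hLV
  exact ⟨(K', L'), ⟨hK', hL', hUV.mono h2 h4⟩, h1, h3⟩

lemma cont_aux {X : Type*} (A : ℕ → Set X) (hmono : Monotone A)
    (T : ∀ n, TopologicalSpace (A n))
    (hcont : ∀ n, Continuous (Set.inclusion (hmono (Nat.le_succ n))))
    (m n : ℕ) (h : m ≤ n) : Continuous (Set.inclusion (hmono h)) := by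
  induction n, h using Nat.le_induction with
  | base => exact continuous_id
  | succ n h ih => exact (hcont n).comp ih

lemma mono_aux {X : Type*} (A : ℕ → Set X) (hmono : Monotone A)
    (T : ∀ n, TopologicalSpace (A n)) (n₀ : ℕ) (K : ∀ k, Set (A (n₀ + k)))
    (hK : ∀ k, Set.inclusion (hmono (Nat.le_succ (n₀ + k))) '' K k ⊆ interior (K (k + 1))) :
    Monotone (fun k => ((↑) : A (n₀ + k) → X) '' K k) := by
  refine monotone_nat_of_le_succ fun k => ?_
  rintro _ ⟨p, hp, rfl⟩
  exact ⟨_, interior_subset (hK k ⟨p, hp, rfl⟩), rfl⟩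

lemma open_aux {X : Type*} (A : ℕ → Set X) (hmono : Monotone A)
    (T : ∀ n, TopologicalSpace (A n))
    (hcont : ∀ n, Continuous (Set.inclusion (hmono (Nat.le_succ n))))
    (n₀ : ℕ) (K : ∀ k, Set (A (n₀ + k)))
    (hK : ∀ k, Set.inclusion (hmono (Nat.le_succ (n₀ + k))) '' K k ⊆ interior (K (k + 1))) :
    @IsOpen X (⨆ n, (T n).coinduced ((↑) : A n → X)) (⋃ k, ((↑) : A (n₀ + k) → X) '' K k) := by
  rw [isOpen_iSup_iff]
  intro m
  rw [isOpen_coinduced, isOpen_iff_mem_nhds]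
  intro p hp
  obtain ⟨k, hk⟩ := Set.mem_iUnion.1 hp
  have hm : m ≤ n₀ + (k + m + 1) := by omega
  obtain ⟨q, hq, hqp⟩ := mono_aux A hmono T n₀ K hK (Nat.le_add_right k m) hk
  have h1 := hK (k + m) ⟨q, hq, rfl⟩
  have hc := cont_aux A hmono T hcont m _ hm
  have he : Set.inclusion (hmono hm) p = Set.inclusion (hmono (Nat.le_succ (n₀ + (k+m)))) q :=
    Subtype.ext hqp.symm
  refine Filter.mem_of_superset ((isOpen_interior.preimage hc).mem_nhds
    (show Set.inclusion (hmono hm) p ∈ interior (K (k + m + 1)) from he ▸ h1)) ?_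
  intro r hr
  exact Set.mem_iUnion.2 ⟨k + m + 1, _, interior_subset hr, rfl⟩

/-- If `X = ⋃ n, A n` carries the DL-topology of an increasing sequence of
topological spaces `(A n, T n)` (inclusions continuous) and each `A n` is a locally
compact Hausdorff space, then `X` is Hausdorff. -/
theorem stmt2 {X : Type*} (A : ℕ → Set X) (hmono : Monotone A)
    (hunion : ⋃ n, A n = Set.univ)
    (T : ∀ n, TopologicalSpace (A n))
    (hcont : ∀ n, @Continuous _ _ (T n) (T (n + 1))
      (Set.inclusion (hmono (Nat.le_succ n))))
    (hlc : ∀ n, @LocallyCompactSpace (A n) (T n))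
    (hT2 : ∀ n, @T2Space (A n) (T n)) :
    @T2Space X (⨆ n, (T n).coinduced ((↑) : A n → X)) := by
  refine @T2Space.mk X (_) ?_
  intro x y hxy
  obtain ⟨a, ha⟩ := Set.mem_iUnion.1 (hunion ▸ Set.mem_univ x : x ∈ ⋃ n, A n)
  obtain ⟨b, hb⟩ := Set.mem_iUnion.1 (hunion ▸ Set.mem_univ y : y ∈ ⋃ n, A n)
  obtain ⟨n₀, hx, hy⟩ : ∃ n₀, x ∈ A n₀ ∧ y ∈ A n₀ :=
    ⟨max a b, hmono (le_max_left _ _) ha, hmono (le_max_right _ _) hb⟩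
  let S : ℕ → Type _ := fun k => {p : Set (A (n₀ + k)) × Set (A (n₀ + k)) //
    IsCompact p.1 ∧ IsCompact p.2 ∧ Disjoint p.1 p.2}
  have hstep : ∀ k (s : S k), ∃ t : S (k + 1),
      Set.inclusion (hmono (Nat.le_succ (n₀ + k))) '' s.1.1 ⊆ interior t.1.1 ∧
      Set.inclusion (hmono (Nat.le_succ (n₀ + k))) '' s.1.2 ⊆ interior t.1.2 := by
    rintro k ⟨⟨K, L⟩, hK, hL, hd⟩
    have := hlc (n₀ + k + 1)
    have := hT2 (n₀ + k + 1)
    obtain ⟨p, hp, h⟩ := step_aux _ (hcont (n₀ + k)) (Set.inclusion_injective _) K L hK hL hd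
    exact ⟨⟨p, hp⟩, h⟩
  choose g hg using hstep
  let s0 : S 0 := ⟨({⟨x, hx⟩}, {⟨y, hy⟩}), isCompact_singleton, isCompact_singleton, by
    simpa using hxy⟩
  let s : ∀ k, S k := fun k => Nat.rec s0 g k
  have h1 := fun k => (hg k (s k)).1
  have h2 := fun k => (hg k (s k)).2
  refine ⟨_, _, open_aux A hmono T hcont n₀ (fun k => (s k).1.1) h1,
    open_aux A hmono T hcont n₀ (fun k => (s k).1.2) h2,
    Set.mem_iUnion.2 ⟨0, ⟨x, hx⟩, rfl, rfl⟩, Set.mem_iUnion.2 ⟨0, ⟨y, hy⟩, rfl, rfl⟩, ?_⟩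
  rw [Set.disjoint_left]
  intro z hz1 hz2
  obtain ⟨i, hi⟩ := Set.mem_iUnion.1 hz1
  obtain ⟨j, hj⟩ := Set.mem_iUnion.1 hz2
  obtain ⟨p, hp, hpz⟩ := mono_aux A hmono T n₀ (fun k => (s k).1.1) h1 (le_max_left i j) hi
  obtain ⟨q, hq, hqz⟩ := mono_aux A hmono T n₀ (fun k => (s k).1.2) h2 (le_max_right i j) hj
  have hpq : p = q := Subtype.ext (hpz.trans hqz.symm)
  subst hpq
  exact Set.disjoint_left.1 (s (max i j)).2.2.2 hp hq
end

section
/- Let X be a set that is the union of an increasing sequence X₁ ⊆ X₂ ⊆ ⋯ of subsets, where each Xₙ carries a topology such that every inclusion Xₙ → Xₙ₊₁ is continuous, and equip X with the DL-topology. If each Xₙ is a T1 space and K ⊆ X is compact, then there exists n such that K ⊆ Xₙ. -/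
/-- If `X = ⋃ n, A n` carries the DL-topology of an increasing sequence of
topological spaces `(A n, T n)` (inclusions continuous), each `A n` is T1, and `K ⊆ X` is
compact, then `K ⊆ A n` for some `n`. -/
theorem stmt3 {X : Type*} (A : ℕ → Set X) (hmono : Monotone A)
    (hunion : ⋃ n, A n = Set.univ)
    (T : ∀ n, TopologicalSpace (A n))
    (hcont : ∀ n, @Continuous _ _ (T n) (T (n + 1))
      (Set.inclusion (hmono (Nat.le_succ n))))
    (hT1 : ∀ n, @T1Space (A n) (T n))
    (K : Set X) (hK : @IsCompact X (⨆ n, (T n).coinduced ((↑) : A n → X)) K) :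
    ∃ n, K ⊆ A n := by
  by_contra hcon
  have hx : ∀ n, ∃ x, x ∈ K ∧ x ∉ A n := by
    intro n
    by_contra h
    exact hcon ⟨n, fun y hy => by
      by_contra hy'
      exact h ⟨y, hy, hy'⟩⟩
  choose x hxK hxA using hx
  letI τ : TopologicalSpace X := ⨆ n, (T n).coinduced ((↑) : A n → X)
  have hopen : ∀ m, IsOpen {y : X | ∀ n, m ≤ n → y ≠ x n} := by
    intro m
    refine isOpen_iSup_iff.2 fun k => ?_
    refine isOpen_coinduced.2 ?_
    letI := T k
    haveI := hT1 k
    have hfin : ({z : A k | ∃ n, n < k ∧ m ≤ n ∧ (z : X) = x n}).Finite := by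
      refine Set.Finite.of_finite_image (f := ((↑) : A k → X))
        (((Set.finite_lt_nat k).image x).subset ?_) Subtype.val_injective.injOn
      rintro _ ⟨z, ⟨n, hn, _, hz⟩, rfl⟩
      exact ⟨n, hn, hz.symm⟩
    convert hfin.isClosed.isOpen_compl using 1
    ext z
    constructor
    · rintro h ⟨n, _, hm, hz⟩
      exact h n hm hz
    · intro h n hm hz
      refine h ⟨n, ?_, hm, hz⟩
      by_contra hk
      exact hxA n (hz ▸ hmono (not_lt.1 hk) z.2)
  obtain ⟨m, hm⟩ := hK.elim_directed_cover _ hopen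
    (by
      intro y _
      have hy : y ∈ ⋃ n, A n := hunion ▸ Set.mem_univ y
      obtain ⟨k, hk⟩ := Set.mem_iUnion.1 hy
      refine Set.mem_iUnion.2 ⟨k, fun n hn h => hxA n ?_⟩
      exact h ▸ hmono hn hk)
    (Monotone.directed_le (fun a b hab y hy n hn => hy n (hab.trans hn)))
  exact hm (hxK m) m le_rfl rfl
end

section
/- Let X be a set that is the union of an increasing sequence X₁ ⊆ X₂ ⊆ ⋯ of subsets, where each Xₙ carries a topology such that every inclusion Xₙ → Xₙ₊₁ is a topological embedding (i.e. the sequence is strict), and equip X with the DL-topology. Then each inclusion εₙ : Xₙ → X is a topological embedding. -/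
theorem stmt4_cont {X : Type*} (A : ℕ → Set X) (hmono : Monotone A)
    (T : ∀ n, TopologicalSpace (A n))
    (hemb : ∀ n, @Topology.IsEmbedding _ _ (T n) (T (n + 1))
      (Set.inclusion (hmono (Nat.le_succ n)))) (m k : ℕ) (h : m ≤ k) (S : Set X)
    (hS : @IsOpen _ (T k) ((↑) ⁻¹' S : Set (A k))) : @IsOpen _ (T m) ((↑) ⁻¹' S : Set (A m)) := by
  induction k, h using Nat.le_induction with
  | base => exact hS
  | succ k h ih =>
    apply ih
    exact @IsOpen.preimage _ _ (T k) (T (k+1)) _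
      (@Topology.IsEmbedding.continuous _ _ _ (T k) (T (k+1)) (hemb k)) _ hS

/-- If `X = ⋃ n, A n` carries the DL-topology of a *strict* increasing
sequence of topological spaces `(A n, T n)` (i.e. each inclusion `A n → A (n+1)` is a
topological embedding), then every inclusion `A n → X` is a topological embedding. -/
theorem stmt4 {X : Type*} (A : ℕ → Set X) (hmono : Monotone A)
    (hunion : ⋃ n, A n = Set.univ)
    (T : ∀ n, TopologicalSpace (A n))
    (hemb : ∀ n, @Topology.IsEmbedding _ _ (T n) (T (n + 1))
      (Set.inclusion (hmono (Nat.le_succ n)))) :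
    ∀ n, @Topology.IsEmbedding _ _ (T n) (⨆ m, (T m).coinduced ((↑) : A m → X))
      ((↑) : A n → X) := by
  intro n
  have step : ∀ (k : ℕ) (S : Set X), ∃ S' : Set X,
      @IsOpen _ (T k) ((↑) ⁻¹' S : Set (A k)) →
      (@IsOpen _ (T (k+1)) ((↑) ⁻¹' S' : Set (A (k+1))) ∧ ∀ x ∈ A k, (x ∈ S' ↔ x ∈ S)) := by
    intro k S
    by_cases hS : @IsOpen _ (T k) ((↑) ⁻¹' S : Set (A k))
    · have h1 := (hemb k).1.1
      rw [h1] at hS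
      obtain ⟨V, hV, hVS⟩ := hS
      refine ⟨(↑) '' V, fun _ => ⟨?_, ?_⟩⟩
      · rwa [Set.preimage_image_eq _ Subtype.val_injective]
      · intro x hx
        have := Set.ext_iff.1 hVS ⟨x, hx⟩
        simp only [Set.mem_preimage] at this
        rw [← this]
        constructor
        · rintro ⟨y, hy, rfl⟩
          exact hy
        · intro hy
          exact ⟨_, hy, rfl⟩
    · exact ⟨∅, fun h => absurd h hS⟩
  choose f hf using step
  refine @Topology.IsEmbedding.mk _ _ (T n) (_) _ (@Topology.IsInducing.mk _ _ (T n) (_) _ ?_)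
    Subtype.val_injective
  apply le_antisymm
  · rw [← continuous_iff_le_induced, continuous_iff_coinduced_le]
    exact le_iSup (fun m => (T m).coinduced ((↑) : A m → X)) n
  · intro U hU
    let S : ℕ → Set X := fun k => Nat.rec ((↑) '' U) (fun k s => f (n + k) s) k
    have hS : ∀ k, @IsOpen _ (T (n+k)) ((↑) ⁻¹' (S k) : Set (A (n+k))) := by
      intro k
      induction k with
      | zero =>
        change @IsOpen _ (T n) (Subtype.val ⁻¹' (Subtype.val '' U) : Set (A n))
        rwa [Set.preimage_image_eq _ Subtype.val_injective]
      | succ k ih => exact (hf (n+k) (S k) ih).1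
    have hs : ∀ k, ∀ x ∈ A (n+k), (x ∈ S (k+1) ↔ x ∈ S k) :=
      fun k => (hf (n+k) (S k) (hS k)).2
    have hle : ∀ k j, k ≤ j → ∀ x ∈ A (n+k), (x ∈ S j ↔ x ∈ S k) := by
      intro k j h x hx
      induction j, h using Nat.le_induction with
      | base => rfl
      | succ j h ih => rw [← ih]; exact hs j x (hmono (by omega) hx)
    have hW : ∀ k, ∀ x ∈ A (n+k), ((∃ j, x ∈ A (n+j) ∧ x ∈ S j) ↔ x ∈ S k) := by
      intro k x hx
      constructor
      · rintro ⟨j, hj, hxj⟩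
        rcases le_total k j with h | h
        · exact (hle k j h x hx).1 hxj
        · exact (hle j k h x hj).2 hxj
      · exact fun h => ⟨k, hx, h⟩
    refine ⟨{x | ∃ j, x ∈ A (n+j) ∧ x ∈ S j}, ?_, ?_⟩
    · rw [isOpen_iSup_iff]
      intro m
      rw [isOpen_coinduced]
      have h := stmt4_cont A hmono T hemb m (n+m) (by omega) (S m) (hS m)
      convert h using 1
      ext x
      exact hW m x (hmono (by omega) x.2)
    · ext x
      refine (hW 0 x x.2).trans ?_
      change (x : X) ∈ (↑) '' U ↔ _
      simp
end

section
/- Let E be a finite-dimensional real normed vector space and let N : E → (E →L[ℝ] E) be a smooth field of linear endomorphisms of E satisfying the Nijenhuis condition [NX, NY] = N([NX, Y] + [X, NY] − N([X, Y])) for all smooth vector fields X, Y : E → E. Define [X, Y]_N = [NX, Y] + [X, NY] − N([X, Y]). Then [·,·]_N satisfies the Jacobi identity: for all smooth vector fields X, Y, Z : E → E, [X, [Y, Z]_N]_N + [Y, [Z, X]_N]_N + [Z, [X, Y]_N]_N = 0. -/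
/-- The Lie bracket of two vector fields `V W : E → E`:
`[V, W](p) = DW(p)(V(p)) − DV(p)(W(p))`. -/
noncomputable def vfBracket {E : Type*} [NormedAddCommGroup E] [NormedSpace ℝ E]
    (V W : E → E) : E → E :=
  fun p => fderiv ℝ W p (V p) - fderiv ℝ V p (W p)

/-- The vector field `NX` obtained by applying a field of endomorphisms
`N : E → (E →L[ℝ] E)` pointwise to a vector field `X`. -/
def nApp {E : Type*} [NormedAddCommGroup E] [NormedSpace ℝ E]
    (N : E → (E →L[ℝ] E)) (X : E → E) : E → E :=
  fun p => N p (X p)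

/-- The bracket `[X, Y]_N = [NX, Y] + [X, NY] − N([X, Y])` associated with a field of
endomorphisms `N`. -/
noncomputable def nBracket {E : Type*} [NormedAddCommGroup E] [NormedSpace ℝ E]
    (N : E → (E →L[ℝ] E)) (X Y : E → E) : E → E :=
  vfBracket (nApp N X) Y + vfBracket X (nApp N Y) - nApp N (vfBracket X Y)

theorem lie_nij_jacobi {L : Type*} [LieRing L] (n : L →+ L)
    (h : ∀ x y : L, ⁅n x, n y⁆ = n (⁅n x, y⁆ + ⁅x, n y⁆ - n ⁅x, y⁆)) (x y z : L) :
    (⁅n x, ⁅n y, z⁆ + ⁅y, n z⁆ - n ⁅y, z⁆⁆ + ⁅x, n (⁅n y, z⁆ + ⁅y, n z⁆ - n ⁅y, z⁆)⁆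
      - n ⁅x, ⁅n y, z⁆ + ⁅y, n z⁆ - n ⁅y, z⁆⁆) +
    (⁅n y, ⁅n z, x⁆ + ⁅z, n x⁆ - n ⁅z, x⁆⁆ + ⁅y, n (⁅n z, x⁆ + ⁅z, n x⁆ - n ⁅z, x⁆)⁆
      - n ⁅y, ⁅n z, x⁆ + ⁅z, n x⁆ - n ⁅z, x⁆⁆) +
    (⁅n z, ⁅n x, y⁆ + ⁅x, n y⁆ - n ⁅x, y⁆⁆ + ⁅z, n (⁅n x, y⁆ + ⁅x, n y⁆ - n ⁅x, y⁆)⁆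
      - n ⁅z, ⁅n x, y⁆ + ⁅x, n y⁆ - n ⁅x, y⁆⁆) = 0 := by
  have key : ∀ x y z : L,
      ⁅n x, ⁅n y, z⁆ + ⁅y, n z⁆ - n ⁅y, z⁆⁆ + ⁅x, n (⁅n y, z⁆ + ⁅y, n z⁆ - n ⁅y, z⁆)⁆
        - n ⁅x, ⁅n y, z⁆ + ⁅y, n z⁆ - n ⁅y, z⁆⁆
      = ⁅n x, ⁅n y, z⁆⁆ + ⁅n x, ⁅y, n z⁆⁆ + ⁅x, ⁅n y, n z⁆⁆
        - n (⁅n x, ⁅y, z⁆⁆ + ⁅x, ⁅n y, z⁆⁆ + ⁅x, ⁅y, n z⁆⁆) + n (n ⁅x, ⁅y, z⁆⁆) := by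
    intro x y z
    rw [← h y z, lie_sub, lie_add, h x ⁅y, z⁆]
    simp only [lie_sub, lie_add, map_sub, map_add]
    abel
  rw [key, key, key]
  have j1 := lie_jacobi (n x) (n y) z
  have j2 := lie_jacobi (n x) y (n z)
  have j3 := lie_jacobi x (n y) (n z)
  have k1 := congrArg n (lie_jacobi (n x) y z)
  have k2 := congrArg n (lie_jacobi x (n y) z)
  have k3 := congrArg n (lie_jacobi x y (n z))
  have l := congrArg n (congrArg n (lie_jacobi x y z))
  simp only [map_add, map_zero] at *
  linear_combination (norm := abel) j1 + j2 + j3 - k1 - k2 - k3 + l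

theorem vfBracket_eq_lie {E : Type*} [NormedAddCommGroup E] [NormedSpace ℝ E]
    (V W : E → E) : vfBracket V W = VectorField.lieBracket ℝ V W := rfl

theorem vfBracket_smooth {E : Type*} [NormedAddCommGroup E] [NormedSpace ℝ E]
    {V W : E → E} (hV : ContDiff ℝ (⊤ : ℕ∞) V) (hW : ContDiff ℝ (⊤ : ℕ∞) W) :
    ContDiff ℝ (⊤ : ℕ∞) (vfBracket V W) :=
  ContDiff.lieBracket_vectorField hV hW le_rfl

theorem nApp_smooth {E : Type*} [NormedAddCommGroup E] [NormedSpace ℝ E]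
    {N : E → (E →L[ℝ] E)} (hN : ContDiff ℝ (⊤ : ℕ∞) N)
    {V : E → E} (hV : ContDiff ℝ (⊤ : ℕ∞) V) :
    ContDiff ℝ (⊤ : ℕ∞) (nApp N V) :=
  hN.clm_apply hV

/-- Smooth vector fields. -/
def smoothVF (E : Type*) [NormedAddCommGroup E] [NormedSpace ℝ E] : AddSubgroup (E → E) where
  carrier := {V | ContDiff ℝ (⊤ : ℕ∞) V}
  zero_mem' := by
    show ContDiff ℝ (⊤ : ℕ∞) (fun _ : E => (0 : E))
    exact contDiff_const
  add_mem' := fun {a b} (ha : ContDiff ℝ (⊤ : ℕ∞) a) (hb : ContDiff ℝ (⊤ : ℕ∞) b) => ha.add hb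
  neg_mem' := fun {a} (ha : ContDiff ℝ (⊤ : ℕ∞) a) => ha.neg

theorem smoothVF_diff {E : Type*} [NormedAddCommGroup E] [NormedSpace ℝ E]
    (V : smoothVF E) (p : E) : DifferentiableAt ℝ V.1 p :=
  have h : ContDiff ℝ (⊤ : ℕ∞) V.1 := V.2
  (h.differentiable (by simp)).differentiableAt

noncomputable instance smoothVFLieRing {E : Type*} [NormedAddCommGroup E] [NormedSpace ℝ E]
    [CompleteSpace E] : LieRing (smoothVF E) where
  bracket V W := ⟨vfBracket V.1 W.1, vfBracket_smooth V.2 W.2⟩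
  add_lie V W Z := by
    apply Subtype.ext
    funext p
    exact VectorField.lieBracket_add_left (smoothVF_diff V p) (smoothVF_diff W p)
  lie_add V W Z := by
    apply Subtype.ext
    funext p
    exact VectorField.lieBracket_add_right (smoothVF_diff W p) (smoothVF_diff Z p)
  lie_self V := by
    apply Subtype.ext
    exact VectorField.lieBracket_self
  leibniz_lie V W Z := by
    apply Subtype.ext
    funext p
    refine VectorField.leibniz_identity_lieBracket (n := (⊤ : ℕ∞)) ?_ (ContDiff.contDiffAt V.2)
      (ContDiff.contDiffAt W.2) (ContDiff.contDiffAt Z.2)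
    simp only [minSmoothness_of_isRCLikeNormedField]
    exact WithTop.coe_le_coe.2 (le_top : (2 : ℕ∞) ≤ ⊤)

/-- The action of a smooth endomorphism field on smooth vector fields. -/
def nHom {E : Type*} [NormedAddCommGroup E] [NormedSpace ℝ E]
    (N : E → (E →L[ℝ] E)) (hN : ContDiff ℝ (⊤ : ℕ∞) N) : smoothVF E →+ smoothVF E where
  toFun V := ⟨nApp N V.1, nApp_smooth hN V.2⟩
  map_zero' := by
    apply Subtype.ext
    funext p
    exact map_zero (N p)
  map_add' V W := by
    apply Subtype.ext
    funext p
    exact map_add (N p) _ _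

/-- Let `E` be a finite-dimensional real normed space and `N` a smooth
field of endomorphisms of `E` satisfying the Nijenhuis condition
`[NX, NY] = N([NX, Y] + [X, NY] − N([X, Y]))` for all smooth vector fields `X, Y`.
Then the bracket `[·,·]_N` satisfies the Jacobi identity on smooth vector fields. -/
theorem stmt10 {E : Type*} [NormedAddCommGroup E] [NormedSpace ℝ E]
    [FiniteDimensional ℝ E]
    (N : E → (E →L[ℝ] E)) (hN : ContDiff ℝ (⊤ : ℕ∞) N)
    (hNij : ∀ X Y : E → E, ContDiff ℝ (⊤ : ℕ∞) X → ContDiff ℝ (⊤ : ℕ∞) Y →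
      vfBracket (nApp N X) (nApp N Y) = nApp N (nBracket N X Y)) :
    ∀ X Y Z : E → E, ContDiff ℝ (⊤ : ℕ∞) X → ContDiff ℝ (⊤ : ℕ∞) Y → ContDiff ℝ (⊤ : ℕ∞) Z →
      nBracket N X (nBracket N Y Z) + nBracket N Y (nBracket N Z X) +
        nBracket N Z (nBracket N X Y) = 0 := by
  intro X Y Z hX hY hZ
  have : CompleteSpace E := FiniteDimensional.complete ℝ E
  have := lie_nij_jacobi (nHom N hN) (fun x y => Subtype.ext (hNij x.1 y.1 x.2 y.2))
    (⟨X, hX⟩ : smoothVF E) ⟨Y, hY⟩ ⟨Z, hZ⟩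
  exact congrArg Subtype.val this
end
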